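/- Suppose the standing assumptions hold and consider one step of the implicit scheme: x^{k+1} = argmin_{x∈X} α f(x) + α⟨L_d(G) x^k + E_s(G) u^k, x⟩ + B_ψ(x, x^k), u^{k+1} = u^k + α E_s(G)ᵀ x^{k+1}, with α > 0. Let λ be the largest eigenvalue of L_d(G) and set c = d − α s (entrywise). Then V(x^{k+1}, u^{k+1}) − V(x^k, u^k) ≤ α(ℓ(x*) − ℓ(x^{k+1})) − (α/2)⟨L_c(G) x^{k+1}, x^{k+1}⟩ − ((1 − α λ)/2)‖x^{k+1} − x^k‖₂² − (α/2)⟨L_d(G) x^k, x^k⟩. -/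

import Mathlib

open scoped RealInnerProductSpace
open Finset

noncomputable section

/-- `ℝ^n` with the Euclidean (l2) structure. -/
abbrev Vec (n : ℕ) := EuclideanSpace ℝ (Fin n)

/-- Entry `(i, e)` of the incidence matrix `E(G)` of an oriented graph:
`+1` if `i` is the head of edge `e`, `-1` if it is the tail, `0` otherwise. -/
def incid {V Ed : Type*} [DecidableEq V] (head tail : Ed → V) (i : V) (e : Ed) : ℝ :=
  if i = head e then 1 else if i = tail e then -1 else 0

/-- Action of `E_w(G) = (E(G) diag(√w)) ⊗ I_n` on an edge-indexed block vector. -/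
def esOp {n : ℕ} {V Ed : Type*} [Fintype Ed] [DecidableEq V] (head tail : Ed → V)
    (w : Ed → ℝ) (u : Ed → Vec n) : V → Vec n :=
  fun i => ∑ e, (incid head tail i e * Real.sqrt (w e)) • u e

/-- Action of `E_w(G)ᵀ = (diag(√w) E(G)ᵀ) ⊗ I_n` on a node-indexed block vector. -/
def esTOp {n : ℕ} {V Ed : Type*} [Fintype V] [DecidableEq V] (head tail : Ed → V)
    (w : Ed → ℝ) (x : V → Vec n) : Ed → Vec n :=
  fun e => ∑ i, (incid head tail i e * Real.sqrt (w e)) • x i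

/-- Action of the weighted Laplacian `L_w(G) = (E(G) diag(w) E(G)ᵀ) ⊗ I_n`. -/
def lapOp {n : ℕ} {V Ed : Type*} [Fintype V] [Fintype Ed] [DecidableEq V] (head tail : Ed → V)
    (w : Ed → ℝ) (x : V → Vec n) : V → Vec n :=
  fun i => ∑ j, (∑ e, incid head tail i e * w e * incid head tail j e) • x j

/-- Euclidean inner product on the node space `ℝ^{|V| n}`. -/
def innV {n : ℕ} {V : Type*} [Fintype V] (x y : V → Vec n) : ℝ := ∑ i, ⟪x i, y i⟫

/-- Euclidean inner product on the edge space `ℝ^{|Ed| n}`. -/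
def innE {n : ℕ} {Ed : Type*} [Fintype Ed] (u v : Ed → Vec n) : ℝ := ∑ e, ⟪u e, v e⟫

/-- The Cartesian product `X = X₀^{|V|}`. -/
def prodSet {n : ℕ} (V : Type*) (X0 : Set (Vec n)) : Set (V → Vec n) := {x | ∀ i, x i ∈ X0}

/-- `f(x) = ∑ᵢ fᵢ(xᵢ)`. -/
def sumF {n : ℕ} {V : Type*} [Fintype V] (f : V → Vec n → ℝ) (x : V → Vec n) : ℝ :=
  ∑ i, f i (x i)

/-- Bregman divergence `B_ψ(x', x)` for `ψ(x) = ∑ᵢ ψ₀(xᵢ)` with `∇ψ₀ = g0`. -/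
def Bpsi {n : ℕ} {V : Type*} [Fintype V] (psi0 : Vec n → ℝ) (g0 : Vec n → Vec n)
    (x' x : V → Vec n) : ℝ :=
  (∑ i, psi0 (x' i)) - (∑ i, psi0 (x i)) - ∑ i, ⟪g0 (x i), x' i - x i⟫

/-- `g ∈ ∂F(x)`: `g` is a subgradient of `F` at `x` (relative to the domain `Xs`). -/
def IsSubgrad {n : ℕ} {V : Type*} [Fintype V] (F : (V → Vec n) → ℝ) (Xs : Set (V → Vec n))
    (x g : V → Vec n) : Prop :=
  ∀ x' ∈ Xs, F x' - F x ≥ innV (x' - x) g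

/-- The Lyapunov function `V(x, u) = B_ψ(x*, x) + (1/2)‖u − u*‖₂²`. -/
def Vlyap {n : ℕ} {V Ed : Type*} [Fintype V] [Fintype Ed] (psi0 : Vec n → ℝ)
    (g0 : Vec n → Vec n) (xstar : V → Vec n) (ustar : Ed → Vec n)
    (x : V → Vec n) (u : Ed → Vec n) : ℝ :=
  Bpsi psi0 g0 xstar x + (1/2) * innE (u - ustar) (u - ustar)

/-- The shifted Lagrangian `ℓ(x) = f(x) + ⟨E_s(G) u*, x⟩`. -/
def ellF {n : ℕ} {V Ed : Type*} [Fintype V] [Fintype Ed] [DecidableEq V]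
    (f : V → Vec n → ℝ) (head tail : Ed → V) (sw : Ed → ℝ) (ustar : Ed → Vec n)
    (x : V → Vec n) : ℝ :=
  sumF f x + innV (esOp head tail sw ustar) x

/-- The block difference `(Eᵀ x)_e` along the edge `e`. -/
def edgeDiff {n : ℕ} {V Ed : Type*} [Fintype V] [DecidableEq V] (head tail : Ed → V)
    (x : V → Vec n) (e : Ed) : Vec n :=
  ∑ i, incid head tail i e • x i

section EdgeDiff

variable {n : ℕ} {V Ed : Type*} [Fintype V] [DecidableEq V] (head tail : Ed → V)

lemma edgeDiff_sub (x y : V → Vec n) (e : Ed) :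
    edgeDiff head tail (x - y) e = edgeDiff head tail x e - edgeDiff head tail y e := by
  simp [edgeDiff, smul_sub]

lemma esTOp_apply (w : Ed → ℝ) (x : V → Vec n) (e : Ed) :
    esTOp head tail w x e = √(w e) • edgeDiff head tail x e := by
  simp [esTOp, edgeDiff, Finset.smul_sum, smul_smul, mul_comm]

lemma edgeDiff_eq_zero {w : Ed → ℝ} (hw : ∀ e, 0 < w e) {x : V → Vec n}
    (hx : esTOp head tail w x = 0) (e : Ed) : edgeDiff head tail x e = 0 := by
  have h := congrFun hx e
  rw [esTOp_apply] at h
  exact (smul_eq_zero.mp h).resolve_left (Real.sqrt_pos.mpr (hw e)).ne'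

variable [Fintype Ed]

lemma innV_esOp (w : Ed → ℝ) (u : Ed → Vec n) (x : V → Vec n) :
    innV (esOp head tail w u) x = innE u (esTOp head tail w x) := by
  simp only [innV, innE, esOp, esTOp, sum_inner, inner_sum, real_inner_smul_left,
    real_inner_smul_right]
  exact Finset.sum_comm

lemma lapOp_apply (w : Ed → ℝ) (x : V → Vec n) (i : V) :
    lapOp head tail w x i = ∑ e, (incid head tail i e * w e) • edgeDiff head tail x e := by
  simp only [lapOp, edgeDiff, Finset.sum_smul, Finset.smul_sum, smul_smul]
  exact Finset.sum_comm

lemma innV_lapOp (w : Ed → ℝ) (x y : V → Vec n) :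
    innV (lapOp head tail w x) y
      = ∑ e, w e * ⟪edgeDiff head tail x e, edgeDiff head tail y e⟫ := by
  simp only [innV, lapOp_apply, sum_inner, real_inner_smul_left]
  rw [Finset.sum_comm]
  refine Finset.sum_congr rfl fun e _ => ?_
  rw [edgeDiff.eq_def head tail y, inner_sum, Finset.mul_sum]
  refine Finset.sum_congr rfl fun i _ => ?_
  rw [real_inner_smul_right]
  ring

/-- The Laplacian as a linear operator on the Euclidean space `ℝ^{|V| n}`. -/
def lapLinearMap (w : Ed → ℝ) :
    PiLp 2 (fun _ : V => Vec n) →ₗ[ℝ] PiLp 2 (fun _ : V => Vec n) where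
  toFun x := WithLp.toLp 2 (lapOp head tail w x.ofLp)
  map_add' x y := by
    ext1 i
    simp [lapOp, smul_add, Finset.sum_add_distrib]
  map_smul' c x := by
    ext1 i
    simp [lapOp, Finset.smul_sum, smul_comm c]

lemma lapLinearMap_isSymmetric (w : Ed → ℝ) :
    (lapLinearMap (n := n) head tail w).IsSymmetric := by
  intro x y
  have h1 : ⟪lapLinearMap head tail w x, y⟫ = innV (lapOp head tail w x.ofLp) y.ofLp := by
    simp [PiLp.inner_apply, innV, lapLinearMap]
  have h2 : ⟪x, lapLinearMap head tail w y⟫ = innV (lapOp head tail w y.ofLp) x.ofLp := by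
    rw [real_inner_comm]
    simp [PiLp.inner_apply, innV, lapLinearMap]
  rw [h1, h2, innV_lapOp, innV_lapOp]
  simp only [real_inner_comm]

end EdgeDiff

/-- The Rayleigh quotient of a symmetric operator is at most any upper bound of its
eigenvalues. -/
lemma LinearMap.IsSymmetric.inner_le_of_eigenvalues_le {E : Type*} [NormedAddCommGroup E]
    [InnerProductSpace ℝ E] [FiniteDimensional ℝ E] {T : E →ₗ[ℝ] E} (hT : T.IsSymmetric)
    {c : ℝ} (hc : ∀ μ : ℝ, (∃ v : E, v ≠ 0 ∧ T v = μ • v) → μ ≤ c) (x : E) :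
    ⟪T x, x⟫ ≤ c * ⟪x, x⟫ := by
  set b := hT.eigenvectorBasis rfl
  rw [← b.sum_inner_mul_inner (T x) x, ← b.sum_inner_mul_inner x x, Finset.mul_sum]
  refine Finset.sum_le_sum fun i _ => ?_
  have hb : T (b i) = hT.eigenvalues rfl i • b i := hT.apply_eigenvectorBasis rfl i
  have hi : hT.eigenvalues rfl i ≤ c := hc _ ⟨b i, b.orthonormal.ne_zero i, hb⟩
  rw [hT x (b i), hb, real_inner_smul_right, real_inner_comm x (b i), mul_assoc]
  exact mul_le_mul_of_nonneg_right hi (mul_self_nonneg _)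

lemma innV_lapOp_le {n : ℕ} {V Ed : Type*} [Fintype V] [Fintype Ed] [DecidableEq V]
    (head tail : Ed → V) (w : Ed → ℝ) {c : ℝ}
    (hc : ∀ μ : ℝ, (∃ v : V → Vec n, v ≠ 0 ∧ lapOp head tail w v = μ • v) → μ ≤ c)
    (x : V → Vec n) : innV (lapOp head tail w x) x ≤ c * innV x x := by
  have h := (lapLinearMap_isSymmetric (n := n) head tail w).inner_le_of_eigenvalues_le (c := c)
    (fun μ ⟨v, hv, hμ⟩ => hc μ ⟨v.ofLp, fun h => hv (WithLp.ofLp_injective 2 h),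
      congrArg WithLp.ofLp hμ⟩) (WithLp.toLp 2 x)
  rwa [PiLp.inner_apply, PiLp.inner_apply] at h

lemma HasDerivWithinAt.nonneg_of_le_on_Icc {φ : ℝ → ℝ} {s : ℝ}
    (h : HasDerivWithinAt φ s (Set.Icc 0 1) 0) (hmin : ∀ t ∈ Set.Icc (0 : ℝ) 1, φ 0 ≤ φ t) :
    0 ≤ s := by
  have hIoc : HasDerivWithinAt φ s (Set.Ioc 0 1) 0 := h.mono Set.Ioc_subset_Icc_self
  rw [hasDerivWithinAt_iff_tendsto_slope' (by simp)] at hIoc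
  have : (nhdsWithin (0 : ℝ) (Set.Ioc 0 1)).NeBot := by
    rw [nhdsWithin_Ioc_eq_nhdsGT one_pos]
    infer_instance
  refine ge_of_tendsto hIoc (Filter.eventually_of_mem self_mem_nhdsWithin fun t ht => ?_)
  rw [slope_def_field]
  exact div_nonneg (sub_nonneg.mpr (hmin t ⟨ht.1.le, ht.2⟩)) (by linarith [ht.1])

section Gradient

variable {E : Type*} [NormedAddCommGroup E] [InnerProductSpace ℝ E]

lemma ConvexOn.add_smul_sub_le {C : Set E} {F : E → ℝ} (hF : ConvexOn ℝ C F) {y z : E}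
    (hy : y ∈ C) (hz : z ∈ C) {t : ℝ} (ht : t ∈ Set.Icc (0 : ℝ) 1) :
    F (y + t • (z - y)) ≤ F y + t * (F z - F y) := by
  have h := hF.2 hy hz (sub_nonneg.mpr ht.2) ht.1 (by ring)
  have he : y + t • (z - y) = (1 - t) • y + t • z := by module
  rw [he]
  simp only [smul_eq_mul] at h
  linarith

variable [CompleteSpace E]

lemma HasGradientWithinAt.hasDerivWithinAt_segment {C : Set E} (hC : Convex ℝ C) {p : E → ℝ}
    {g y z : E} (hy : y ∈ C) (hz : z ∈ C) (hg : HasGradientWithinAt p g C y) :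
    HasDerivWithinAt (fun t : ℝ => p (y + t • (z - y))) ⟪g, z - y⟫ (Set.Icc 0 1) 0 := by
  have hl : HasDerivWithinAt (fun t : ℝ => y + t • (z - y)) (z - y) (Set.Icc 0 1) 0 := by
    simpa using (((hasDerivAt_id (0 : ℝ)).smul_const (z - y)).const_add y).hasDerivWithinAt
  have hf : HasFDerivWithinAt p (InnerProductSpace.toDual ℝ E g) C (y + (0 : ℝ) • (z - y)) := by
    simpa using hg.hasFDerivWithinAt
  simpa [Function.comp_def] using
    hf.comp_hasDerivWithinAt (0 : ℝ) hl fun t ht => hC.add_smul_sub_mem hy hz ht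

/-- First-order lower bound for a `1`-strongly convex function. -/
lemma half_norm_sq_le_of_strongConvex {C : Set E} (hC : Convex ℝ C) {p : E → ℝ} {g y z : E}
    (hp : ConvexOn ℝ C fun x => p x - (1 / 2) * ‖x‖ ^ 2) (hy : y ∈ C) (hz : z ∈ C)
    (hg : HasGradientWithinAt p g C y) :
    1 / 2 * ⟪z - y, z - y⟫ ≤ p z - p y - ⟪g, z - y⟫ := by
  have hd := hg.hasDerivWithinAt_segment hC hy hz
  have hq : HasDerivWithinAt (fun t : ℝ => t * (p z - p y - 1 / 2 * ⟪z - y, z - y⟫)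
      + t ^ 2 * (1 / 2 * ⟪z - y, z - y⟫)) (p z - p y - 1 / 2 * ⟪z - y, z - y⟫)
      (Set.Icc 0 1) 0 := by
    have h := ((hasDerivAt_id' (0 : ℝ)).mul_const (p z - p y - 1 / 2 * ⟪z - y, z - y⟫)).fun_add
      ((hasDerivAt_pow 2 (0 : ℝ)).mul_const (1 / 2 * ⟪z - y, z - y⟫))
    simpa using h.hasDerivWithinAt
  have h := (hq.sub hd).nonneg_of_le_on_Icc fun t ht => by
    have hc := hp.add_smul_sub_le hy hz ht
    have hz' : ‖z‖ ^ 2 = ‖y‖ ^ 2 + 2 * ⟪y, z - y⟫ + ⟪z - y, z - y⟫ := by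
      rw [real_inner_self_eq_norm_sq, ← norm_add_sq_real, add_sub_cancel]
    have ht' : ‖y + t • (z - y)‖ ^ 2
        = ‖y‖ ^ 2 + 2 * (t * ⟪y, z - y⟫) + t ^ 2 * ⟪z - y, z - y⟫ := by
      rw [norm_add_sq_real, real_inner_smul_right, norm_smul, mul_pow,
        real_inner_self_eq_norm_sq, Real.norm_eq_abs, sq_abs]
    simp only [hz', ht'] at hc
    simp only [Pi.sub_apply, zero_smul, add_zero, zero_mul]
    nlinarith [hc]
  linarith

end Gradient

section Blocks

variable {n : ℕ} {V : Type*} [Fintype V]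

lemma innV_add_left (x y z : V → Vec n) : innV (x + y) z = innV x z + innV y z := by
  simp [innV, inner_add_left, Finset.sum_add_distrib]

lemma innV_add_smul_sub (q x y : V → Vec n) (t : ℝ) :
    innV q (x + t • (y - x)) = innV q x + t * (innV q y - innV q x) := by
  simp only [innV, Pi.add_apply, Pi.smul_apply, Pi.sub_apply, inner_add_right,
    real_inner_smul_right, inner_sub_right, Finset.sum_add_distrib, ← Finset.mul_sum,
    Finset.sum_sub_distrib]

lemma half_innV_le_Bpsi {X0 : Set (Vec n)} (hX0 : Convex ℝ X0) {psi0 : Vec n → ℝ}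
    {g0 : Vec n → Vec n} (hg : ∀ y ∈ X0, HasGradientWithinAt psi0 (g0 y) X0 y)
    (hsc : ConvexOn ℝ X0 fun y => psi0 y - (1 / 2) * ‖y‖ ^ 2) {x y : V → Vec n}
    (hx : x ∈ prodSet V X0) (hy : y ∈ prodSet V X0) :
    1 / 2 * innV (y - x) (y - x) ≤ Bpsi psi0 g0 y x := by
  simp only [innV, Bpsi, Finset.mul_sum, ← Finset.sum_sub_distrib]
  exact Finset.sum_le_sum fun i _ =>
    half_norm_sq_le_of_strongConvex hX0 hsc (hx i) (hy i) (hg _ (hx i))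

/-- The three-point inequality for a Bregman proximal step. -/
lemma bregman_three_point {X0 : Set (Vec n)} (hX0 : Convex ℝ X0) {psi0 : Vec n → ℝ}
    {g0 : Vec n → Vec n} (hg : ∀ y ∈ X0, HasGradientWithinAt psi0 (g0 y) X0 y)
    {f : V → Vec n → ℝ} (hf : ∀ i, ConvexOn ℝ X0 (f i)) {alpha : ℝ} (halpha : 0 ≤ alpha)
    {q xk x y : V → Vec n} (hx : x ∈ prodSet V X0) (hy : y ∈ prodSet V X0)
    (hmin : ∀ z ∈ prodSet V X0,
      alpha * sumF f x + alpha * innV q x + Bpsi psi0 g0 x xk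
        ≤ alpha * sumF f z + alpha * innV q z + Bpsi psi0 g0 z xk) :
    alpha * sumF f x + alpha * innV q x + Bpsi psi0 g0 x xk + Bpsi psi0 g0 y x
      ≤ alpha * sumF f y + alpha * innV q y + Bpsi psi0 g0 y xk := by
  set c := alpha * (sumF f y - sumF f x) + alpha * (innV q y - innV q x)
    - ∑ i, ⟪g0 (xk i), y i - x i⟫ with hc
  have hd : HasDerivWithinAt (fun t : ℝ => ∑ i, psi0 (x i + t • (y i - x i)))
      (∑ i, ⟪g0 (x i), y i - x i⟫) (Set.Icc 0 1) 0 :=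
    HasDerivWithinAt.fun_sum fun i _ =>
      (hg _ (hx i)).hasDerivWithinAt_segment hX0 (hx i) (hy i)
  have hl : HasDerivWithinAt (fun t : ℝ => t * c) c (Set.Icc 0 1) 0 := by
    simpa using ((hasDerivAt_id (0 : ℝ)).mul_const c).hasDerivWithinAt
  have h := (hd.add hl).nonneg_of_le_on_Icc fun t ht => by
    have hm := hmin (x + t • (y - x)) fun i => hX0.add_smul_sub_mem (hx i) (hy i) ht
    have hft : sumF f (x + t • (y - x)) ≤ sumF f x + t * (sumF f y - sumF f x) := by
      simp only [sumF, ← Finset.sum_sub_distrib, Finset.mul_sum, ← Finset.sum_add_distrib]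
      exact Finset.sum_le_sum fun i _ => (hf i).add_smul_sub_le (hx i) (hy i) ht
    have hin : ∑ i, ⟪g0 (xk i), (x + t • (y - x)) i - xk i⟫
        = ∑ i, ⟪g0 (xk i), x i - xk i⟫ + t * ∑ i, ⟪g0 (xk i), y i - x i⟫ := by
      rw [Finset.mul_sum, ← Finset.sum_add_distrib]
      refine Finset.sum_congr rfl fun i _ => ?_
      rw [← real_inner_smul_right, ← inner_add_right]
      congr 1
      simp only [Pi.add_apply, Pi.smul_apply, Pi.sub_apply]
      abel
    have hft' := mul_le_mul_of_nonneg_left hft halpha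
    rw [innV_add_smul_sub, Bpsi, Bpsi, hin] at hm
    simp only [Pi.add_apply, Pi.smul_apply, Pi.sub_apply, zero_smul, add_zero, zero_mul] at hm ⊢
    rw [hc]
    linarith
  have hB : ∑ i, ⟪g0 (xk i), y i - xk i⟫
      = ∑ i, ⟪g0 (xk i), x i - xk i⟫ + ∑ i, ⟪g0 (xk i), y i - x i⟫ := by
    rw [← Finset.sum_add_distrib]
    refine Finset.sum_congr rfl fun i _ => ?_
    rw [← inner_add_right]
    congr 1
    abel
  rw [hc] at h
  simp only [Bpsi, hB]
  linarith

lemma innE_add_smul_sub_self {Ed : Type*} [Fintype Ed] (u v w : Ed → Vec n) (t : ℝ) :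
    innE (u + t • w - v) (u + t • w - v)
      = innE (u - v) (u - v) + 2 * t * (innE u w - innE v w) + t ^ 2 * innE w w := by
  simp only [innE, Finset.mul_sum, ← Finset.sum_sub_distrib, ← Finset.sum_add_distrib]
  refine Finset.sum_congr rfl fun e _ => ?_
  simp only [Pi.add_apply, Pi.smul_apply, Pi.sub_apply, inner_add_left, inner_add_right,
    inner_sub_left, inner_sub_right, real_inner_smul_left, real_inner_smul_right]
  rw [real_inner_comm (u e) (w e), real_inner_comm (v e) (w e)]
  ring

end Blocks

section Laplacian

variable {n : ℕ} {V Ed : Type*} [Fintype V] [Fintype Ed] [DecidableEq V] (head tail : Ed → V)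

lemma innE_esTOp_self {w : Ed → ℝ} (hw : ∀ e, 0 ≤ w e) (x : V → Vec n) :
    innE (esTOp head tail w x) (esTOp head tail w x) = innV (lapOp head tail w x) x := by
  rw [innV_lapOp, innE]
  refine Finset.sum_congr rfl fun e _ => ?_
  rw [esTOp_apply, real_inner_smul_left, real_inner_smul_right, ← mul_assoc,
    Real.mul_self_sqrt (hw e)]

lemma innV_lapOp_sub_mul (d s : Ed → ℝ) (a : ℝ) (x y : V → Vec n) :
    innV (lapOp head tail (fun e => d e - a * s e) x) y
      = innV (lapOp head tail d x) y - a * innV (lapOp head tail s x) y := by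
  simp only [innV_lapOp, sub_mul, Finset.sum_sub_distrib, Finset.mul_sum, mul_assoc]

lemma innV_lapOp_sub_self (w : Ed → ℝ) (x y : V → Vec n) :
    innV (lapOp head tail w (y - x)) (y - x)
      = innV (lapOp head tail w y) y - 2 * innV (lapOp head tail w x) y
        + innV (lapOp head tail w x) x := by
  simp only [innV_lapOp, Finset.mul_sum, ← Finset.sum_sub_distrib, ← Finset.sum_add_distrib]
  refine Finset.sum_congr rfl fun e _ => ?_
  rw [edgeDiff_sub, real_inner_sub_sub_self, real_inner_comm (edgeDiff head tail x e)]
  ring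

end Laplacian

/-- **One-step descent estimate for the implicit scheme (inequality (22)).**
Under the standing assumptions, consider one step of the implicit scheme with step size
`α > 0`, let `λ` be the largest eigenvalue of `L_d(G)` and `c = d − α s` entrywise.
Then `V(xᵏ⁺¹, uᵏ⁺¹) − V(xᵏ, uᵏ) ≤ α(ℓ(x*) − ℓ(xᵏ⁺¹)) − (α/2)⟨L_c(G)xᵏ⁺¹, xᵏ⁺¹⟩
  − ((1 − αλ)/2)‖xᵏ⁺¹ − xᵏ‖₂² − (α/2)⟨L_d(G)xᵏ, xᵏ⟩`. -/
theorem msd_implicit_one_step_descent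
    {n : ℕ} {V Ed : Type*} [Fintype V] [Fintype Ed] [DecidableEq V]
    -- the graph: a fixed orientation of a finite, undirected, connected graph
    (head tail : Ed → V)
    (hLoop : ∀ e, head e ≠ tail e)
    (hSimple : Function.Injective fun e => Sym2.mk (head e, tail e))
    (hConn : (SimpleGraph.fromRel fun i j => ∃ e, head e = i ∧ tail e = j).Connected)
    -- strictly positive edge weights s and d
    (sw dw : Ed → ℝ) (hsw : ∀ e, 0 < sw e) (hdw : ∀ e, 0 < dw e)
    -- the local constraint set X₀ and the distance generating function ψ₀
    (X0 : Set (Vec n)) (hX0closed : IsClosed X0) (hX0convex : Convex ℝ X0)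
    (psi0 : Vec n → ℝ) (g0 : Vec n → Vec n)
    (hpsi0grad : ∀ y ∈ X0, HasGradientWithinAt psi0 (g0 y) X0 y)
    (hpsi0C1 : ContinuousOn g0 X0)
    (hpsi0SC : ConvexOn ℝ X0 (fun y => psi0 y - (1/2) * ‖y‖^2))
    -- proper closed convex local costs fᵢ
    (f : V → Vec n → ℝ)
    (hfconv : ∀ i, ConvexOn ℝ X0 (f i))
    (hflsc : ∀ i, LowerSemicontinuousOn (f i) X0)
    -- a primal-dual (saddle) point (x*, u*) with g* ∈ ∂f(x*)
    (xstar : V → Vec n) (ustar : Ed → Vec n) (gstar : V → Vec n)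
    (hxstarMem : xstar ∈ prodSet V X0)
    (hgstar : IsSubgrad (sumF f) (prodSet V X0) xstar gstar)
    (hprimal : esTOp head tail sw xstar = 0)
    (hdual : ∀ x' ∈ prodSet V X0, innV (-gstar - esOp head tail sw ustar) (x' - xstar) ≤ 0)
    -- λ is the largest eigenvalue of L_d(G)
    (lam : ℝ)
    (hlamEig : ∃ v : V → Vec n, v ≠ 0 ∧ lapOp head tail dw v = lam • v)
    (hlamMax : ∀ μ : ℝ, (∃ v : V → Vec n, v ≠ 0 ∧ lapOp head tail dw v = μ • v) → μ ≤ lam)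
    -- one step of the implicit scheme (MSD-im) with step size α > 0
    (alpha : ℝ) (halpha : 0 < alpha)
    (xk xkp : V → Vec n) (uk ukp : Ed → Vec n)
    (hxkMem : xk ∈ prodSet V X0)
    (hxUpd : xkp ∈ prodSet V X0 ∧ ∀ y ∈ prodSet V X0,
      alpha * sumF f xkp
          + alpha * innV (lapOp head tail dw xk + esOp head tail sw uk) xkp
          + Bpsi psi0 g0 xkp xk
        ≤ alpha * sumF f y
          + alpha * innV (lapOp head tail dw xk + esOp head tail sw uk) y
          + Bpsi psi0 g0 y xk)
    (huUpd : ukp = uk + alpha • esTOp head tail sw xkp) :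
    Vlyap psi0 g0 xstar ustar xkp ukp - Vlyap psi0 g0 xstar ustar xk uk
      ≤ alpha * (ellF f head tail sw ustar xstar - ellF f head tail sw ustar xkp)
        - alpha / 2 * innV (lapOp head tail (fun e => dw e - alpha * sw e) xkp) xkp
        - (1 - alpha * lam) / 2 * innV (xkp - xk) (xkp - xk)
        - alpha / 2 * innV (lapOp head tail dw xk) xk := by
  obtain ⟨hxkpMem, hmin⟩ := hxUpd
  have hprox := bregman_three_point hX0convex hpsi0grad hfconv halpha.le hxkpMem hxstarMem hmin
  have hstrong := half_innV_le_Bpsi hX0convex hpsi0grad hpsi0SC hxkMem hxkpMem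
  have hray := mul_le_mul_of_nonneg_left
    (innV_lapOp_le head tail dw hlamMax (xkp - xk)) halpha.le
  have hLstar : innV (lapOp head tail dw xk) xstar = 0 := by
    simp [innV_lapOp, edgeDiff_eq_zero head tail hsw hprimal]
  have hEstar (u : Ed → Vec n) : innE u (esTOp head tail sw xstar) = 0 := by
    simp [hprimal, innE]
  rw [innV_lapOp_sub_self] at hray
  simp only [innV_add_left, innV_esOp, hLstar, hEstar] at hprox
  simp only [Vlyap, ellF, innV_esOp, hEstar, huUpd, innE_add_smul_sub_self,
    innE_esTOp_self head tail (fun e => (hsw e).le), innV_lapOp_sub_mul]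
  linarith
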